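/- arXiv:2604.04686 — 3 statements merged into one kernel-verified Lean document; each statement's English description precedes it below -/
import Mathlib

section
/- For all indices t, j : Fin T with t < j and every θ, ∑_τ P θ τ * score θ j τ * r (σ_τ t) (α_τ t) = 0; that is, the expectation under the trajectory distribution of the policy score at time j multiplied by any reward obtained at an earlier time t vanishes (Proposition 1, the zero-expectation identity behind 'causality'). -/
open scoped BigOperators

/-- The probability of a full trajectory `τ = (σ, α)` in a finite-horizon MDP:
`P θ τ = init (σ 0) * ∏ i π θ (σ i) (α i) * ∏_{i+1 < T} trans (σ i) (α i) (σ (i+1))`. -/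
noncomputable def Ptraj {S A : Type} [Fintype S] [Fintype A] {T : ℕ} (hT : 1 ≤ T)
    (init : S → ℝ) (trans : S → A → S → ℝ) (π : ℝ → S → A → ℝ)
    (θ : ℝ) (τ : (Fin T → S) × (Fin T → A)) : ℝ :=
  init (τ.1 ⟨0, hT⟩) * (∏ i : Fin T, π θ (τ.1 i) (τ.2 i)) *
    ∏ i : Fin T,
      if h : (i : ℕ) + 1 < T then trans (τ.1 i) (τ.2 i) (τ.1 ⟨(i : ℕ) + 1, h⟩) else 1

/-- The policy score at time `j` along trajectory `τ`. -/
noncomputable def score {S A : Type} {T : ℕ} (π : ℝ → S → A → ℝ)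
    (θ : ℝ) (j : Fin T) (τ : (Fin T → S) × (Fin T → A)) : ℝ :=
  deriv (fun u => Real.log (π u (τ.1 j) (τ.2 j))) θ

/-- The weight of a trajectory with initial weight `f` and time-dependent action weights `g`. -/
def trajWeight {S A : Type} (trans : S → A → S → ℝ) {n : ℕ} (f : S → ℝ)
    (g : Fin (n + 1) → S → A → ℝ) (σ : Fin (n + 1) → S) (α : Fin (n + 1) → A) : ℝ :=
  f (σ 0) * (∏ i, g i (σ i) (α i)) *
    ∏ i : Fin (n + 1),
      if h : (i : ℕ) + 1 < n + 1 then trans (σ i) (α i) (σ ⟨(i : ℕ) + 1, h⟩) else 1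

/-- Summing out the first state and action turns the initial weight into its one-step
push-forward. -/
theorem sum_trajWeight_succ {S A : Type} [Fintype S] [Fintype A] (trans : S → A → S → ℝ)
    {n : ℕ} (f : S → ℝ) (g : Fin (n + 2) → S → A → ℝ) :
    ∑ σ, ∑ α, trajWeight trans f g σ α =
      ∑ σ, ∑ α, trajWeight trans (fun s' => ∑ s, ∑ a, f s * g 0 s a * trans s a s')
        (fun i => g i.succ) σ α := by
  have key (s : S) (σ : Fin (n + 1) → S) (a : A) (α : Fin (n + 1) → A) :
      trajWeight trans f g (Fin.cons s σ) (Fin.cons a α) =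
        trajWeight trans (fun s' => f s * g 0 s a * trans s a s') (fun i => g i.succ) σ α := by
    unfold trajWeight
    rw [Fin.prod_univ_succ (n := n + 1), Fin.prod_univ_succ (n := n + 1)]
    have h0 : (⟨1, by omega⟩ : Fin (n + 2)) = Fin.succ 0 := rfl
    have h1 : (∏ i : Fin (n + 1), if h : ((i.succ : Fin (n + 2)) : ℕ) + 1 < n + 2 then
          trans ((Fin.cons s σ : Fin (n + 2) → S) i.succ) ((Fin.cons a α : Fin (n + 2) → A) i.succ)
            ((Fin.cons s σ : Fin (n + 2) → S) ⟨((i.succ : Fin (n + 2)) : ℕ) + 1, h⟩) else 1) =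
        ∏ i : Fin (n + 1),
          if h : (i : ℕ) + 1 < n + 1 then trans (σ i) (α i) (σ ⟨(i : ℕ) + 1, h⟩) else 1 := by
      refine Finset.prod_congr rfl fun i _ => ?_
      by_cases h : (i : ℕ) + 1 < n + 1
      · rw [dif_pos h, dif_pos (by simpa using h)]
        rfl
      · rw [dif_neg h, dif_neg (by simpa using h)]
    rw [h1, dif_pos (by simp)]
    simp only [Fin.cons_zero, Fin.cons_succ, Fin.val_zero, zero_add, h0]
    ring
  rw [← (Fin.consEquiv fun _ => S).sum_comp, Fintype.sum_prod_type, Finset.sum_comm]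
  refine Finset.sum_congr rfl fun σ _ => ?_
  have hα (s : S) : ∑ α, trajWeight trans f g ((Fin.consEquiv fun _ => S) (s, σ)) α =
      ∑ α : Fin (n + 1) → A, ∑ a, trajWeight trans f g (Fin.cons s σ) (Fin.cons a α) := by
    rw [← (Fin.consEquiv fun _ => A).sum_comp, Fintype.sum_prod_type, Finset.sum_comm]
    rfl
  simp_rw [hα, key]
  rw [Finset.sum_comm]
  refine Finset.sum_congr rfl fun α _ => ?_
  simp only [trajWeight, Finset.sum_mul]

theorem sum_trajWeight_zero {S A : Type} [Fintype S] [Fintype A] (trans : S → A → S → ℝ)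
    (f : S → ℝ) (g : Fin 1 → S → A → ℝ) :
    ∑ σ, ∑ α, trajWeight trans f g σ α = ∑ s, f s * ∑ a, g 0 s a := by
  rw [← (Equiv.funUnique (Fin 1) S).symm.sum_comp]
  refine Finset.sum_congr rfl fun s _ => ?_
  rw [← (Equiv.funUnique (Fin 1) A).symm.sum_comp, Finset.mul_sum]
  simp [trajWeight]

theorem sum_pushforward {S A : Type} [Fintype S] [Fintype A] {trans : S → A → S → ℝ}
    (htrans : ∀ s a, ∑ s', trans s a s' = 1) (f : S → ℝ) (p : S → A → ℝ) :
    ∑ s', ∑ s, ∑ a, f s * p s a * trans s a s' = ∑ s, f s * ∑ a, p s a := by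
  rw [Finset.sum_comm]
  refine Finset.sum_congr rfl fun s _ => ?_
  rw [Finset.sum_comm, Finset.mul_sum]
  refine Finset.sum_congr rfl fun a _ => ?_
  rw [← Finset.mul_sum, htrans, mul_one]

theorem sum_trajWeight_of_sum_eq_one {S A : Type} [Fintype S] [Fintype A] {trans : S → A → S → ℝ}
    (htrans : ∀ s a, ∑ s', trans s a s' = 1) {n : ℕ} (f : S → ℝ) (g : Fin (n + 1) → S → A → ℝ)
    (hg : ∀ i s, ∑ a, g i s a = 1) :
    ∑ σ, ∑ α, trajWeight trans f g σ α = ∑ s, f s := by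
  induction n generalizing f with
  | zero => simp [sum_trajWeight_zero, hg]
  | succ n ih =>
    rw [sum_trajWeight_succ, ih _ _ fun i => hg i.succ, sum_pushforward htrans]
    simp [hg]

/-- The total weight vanishes if the action weights at time `j` sum to zero and those at all
later times sum to one; the weights at earlier times are arbitrary. -/
theorem sum_trajWeight_eq_zero {S A : Type} [Fintype S] [Fintype A] {trans : S → A → S → ℝ}
    (htrans : ∀ s a, ∑ s', trans s a s' = 1) {n : ℕ} (f : S → ℝ) (g : Fin (n + 1) → S → A → ℝ)
    (j : Fin (n + 1)) (hj : ∀ s, ∑ a, g j s a = 0) (hg : ∀ i, j < i → ∀ s, ∑ a, g i s a = 1) :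
    ∑ σ, ∑ α, trajWeight trans f g σ α = 0 := by
  induction n generalizing f with
  | zero =>
    obtain rfl : j = 0 := Fin.fin_one_eq_zero j
    simp [sum_trajWeight_zero, hj]
  | succ n ih =>
    rw [sum_trajWeight_succ]
    cases j using Fin.cases with
    | zero =>
      rw [sum_trajWeight_of_sum_eq_one htrans _ _ fun i => hg _ i.succ_pos,
        sum_pushforward htrans]
      simp [hj]
    | succ j => exact ih _ _ j hj fun i hi => hg _ (Fin.succ_lt_succ_iff.2 hi)

theorem sum_mul_deriv_log_eq_zero {A : Type} [Fintype A] {p : ℝ → A → ℝ} {θ : ℝ}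
    (hpos : ∀ a, 0 < p θ a) (hsum : ∀ u, ∑ a, p u a = 1)
    (hdiff : ∀ a, DifferentiableAt ℝ (fun u => p u a) θ) :
    ∑ a, p θ a * deriv (fun u => Real.log (p u a)) θ = 0 := by
  have h (a : A) : p θ a * deriv (fun u => Real.log (p u a)) θ = deriv (fun u => p u a) θ := by
    rw [deriv.log (hdiff a) (hpos a).ne', mul_div_cancel₀ _ (hpos a).ne']
  simp_rw [h]
  rw [← deriv_fun_sum fun a _ => hdiff a]
  simp [hsum]

/-- Proposition 1 (the zero-expectation identity behind "causality"): the
expectation, under the trajectory distribution, of the policy score at time `j`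
multiplied by a reward obtained at an earlier time `t < j` vanishes. -/
theorem score_times_past_reward_zero_mean
    {S A : Type} [Fintype S] [Fintype A] [Nonempty S] [Nonempty A]
    {T : ℕ} (hT : 1 ≤ T)
    (init : S → ℝ) (hinit_nonneg : ∀ s, 0 ≤ init s) (hinit_sum : ∑ s, init s = 1)
    (trans : S → A → S → ℝ) (htrans_nonneg : ∀ s a s', 0 ≤ trans s a s')
    (htrans_sum : ∀ s a, ∑ s', trans s a s' = 1)
    (r : S → A → ℝ)
    (π : ℝ → S → A → ℝ)
    (hπ_pos : ∀ θ s a, 0 < π θ s a)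
    (hπ_sum : ∀ θ s, ∑ a, π θ s a = 1)
    (hπ_diff : ∀ s a, Differentiable ℝ (fun θ => π θ s a))
    (t j : Fin T) (htj : t < j) (θ : ℝ) :
    ∑ τ : (Fin T → S) × (Fin T → A),
        Ptraj hT init trans π θ τ * score π θ j τ * r (τ.1 t) (τ.2 t) = 0 := by
  obtain ⟨n, rfl⟩ : ∃ n, T = n + 1 := ⟨T - 1, by omega⟩
  let g : Fin (n + 1) → S → A → ℝ := fun i s a =>
    π θ s a * (if i = j then deriv (fun u => Real.log (π u s a)) θ else 1) *
      (if i = t then r s a else 1)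
  have hw (τ : (Fin (n + 1) → S) × (Fin (n + 1) → A)) :
      Ptraj hT init trans π θ τ * score π θ j τ * r (τ.1 t) (τ.2 t) =
        trajWeight trans init g τ.1 τ.2 := by
    simp only [Ptraj, score, trajWeight, g, Finset.prod_mul_distrib, Finset.prod_ite_eq',
      Finset.mem_univ, if_true, Fin.mk_zero]
    ring
  simp_rw [hw]
  rw [Fintype.sum_prod_type]
  refine sum_trajWeight_eq_zero htrans_sum init g j (fun s => ?_) fun i hi s => ?_
  · simpa [g, htj.ne'] using
      sum_mul_deriv_log_eq_zero (hπ_pos θ s) (fun u => hπ_sum u s) fun a => hπ_diff s a θ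
  · simp [g, hi.ne', (htj.trans hi).ne', hπ_sum]
end

section
/- Fix a trajectory τ and assume init (σ_τ 0) > 0 and trans (σ_τ i) (α_τ i) (σ_τ (i+1)) > 0 for all i with i+1 < T. Then for every θ, deriv (fun u => Real.log (P u τ)) θ = ∑_{j : Fin T} score θ j τ; that is, the score of the full trajectory density equals the sum of the per-step policy scores, since the initial distribution and transition kernel do not depend on θ. -/
open scoped BigOperators

/-- Along a trajectory whose initial state and transitions have positive probability, the
log-density splits into a parameter-free constant and the sum of the log-policies. -/
theorem log_Ptraj_eq {S A : Type} [Fintype S] [Fintype A] {T : ℕ} (hT : 1 ≤ T)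
    (init : S → ℝ) (trans : S → A → S → ℝ) (π : ℝ → S → A → ℝ)
    (hπ_pos : ∀ θ s a, 0 < π θ s a)
    (τ : (Fin T → S) × (Fin T → A))
    (hinit_pos : 0 < init (τ.1 ⟨0, hT⟩))
    (htrans_pos : ∀ i : Fin T, ∀ h : (i : ℕ) + 1 < T,
      0 < trans (τ.1 i) (τ.2 i) (τ.1 ⟨(i : ℕ) + 1, h⟩))
    (θ : ℝ) :
    Real.log (Ptraj hT init trans π θ τ) =
      Real.log (init (τ.1 ⟨0, hT⟩)) + ∑ i : Fin T, Real.log (π θ (τ.1 i) (τ.2 i)) +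
        Real.log (∏ i : Fin T,
          if h : (i : ℕ) + 1 < T then trans (τ.1 i) (τ.2 i) (τ.1 ⟨(i : ℕ) + 1, h⟩) else 1) := by
  have hpolicy : (∏ i : Fin T, π θ (τ.1 i) (τ.2 i)) ≠ 0 :=
    Finset.prod_ne_zero_iff.mpr fun i _ => (hπ_pos θ _ _).ne'
  have htransition : (∏ i : Fin T, if h : (i : ℕ) + 1 < T then
      trans (τ.1 i) (τ.2 i) (τ.1 ⟨(i : ℕ) + 1, h⟩) else 1) ≠ 0 := by
    refine Finset.prod_ne_zero_iff.mpr fun i _ => ?_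
    split_ifs with h
    · exact (htrans_pos i h).ne'
    · exact one_ne_zero
  rw [Ptraj, Real.log_mul (mul_ne_zero hinit_pos.ne' hpolicy) htransition,
    Real.log_mul hinit_pos.ne' hpolicy, Real.log_prod fun i _ => (hπ_pos θ _ _).ne']

/-- The score of the full trajectory density equals the sum of the per-step
policy scores, since the initial distribution and the transition kernel do not
depend on `θ`. -/
theorem trajectory_score_decomposition
    {S A : Type} [Fintype S] [Fintype A] [Nonempty S] [Nonempty A]
    {T : ℕ} (hT : 1 ≤ T)
    (init : S → ℝ) (hinit_nonneg : ∀ s, 0 ≤ init s) (hinit_sum : ∑ s, init s = 1)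
    (trans : S → A → S → ℝ) (htrans_nonneg : ∀ s a s', 0 ≤ trans s a s')
    (htrans_sum : ∀ s a, ∑ s', trans s a s' = 1)
    (π : ℝ → S → A → ℝ)
    (hπ_pos : ∀ θ s a, 0 < π θ s a)
    (hπ_sum : ∀ θ s, ∑ a, π θ s a = 1)
    (hπ_diff : ∀ s a, Differentiable ℝ (fun θ => π θ s a))
    (τ : (Fin T → S) × (Fin T → A))
    (hinit_pos : 0 < init (τ.1 ⟨0, hT⟩))
    (htrans_pos : ∀ i : Fin T, ∀ h : (i : ℕ) + 1 < T,
      0 < trans (τ.1 i) (τ.2 i) (τ.1 ⟨(i : ℕ) + 1, h⟩))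
    (θ : ℝ) :
    deriv (fun u => Real.log (Ptraj hT init trans π u τ)) θ =
      ∑ j : Fin T, score π θ j τ := by
  simp only [log_Ptraj_eq hT init trans π hπ_pos τ hinit_pos htrans_pos, score]
  rw [deriv_add_const, deriv_const_add, deriv_fun_sum]
  exact fun i _ => (hπ_diff _ _ θ).log (hπ_pos θ _ _).ne'
end

section
/- Define J : ℝ → ℝ by J θ = ∑_τ P θ τ * ∑_{t : Fin T} r (σ_τ t) (α_τ t). Then J is differentiable and for every θ, deriv J θ = ∑_τ P θ τ * (∑_{j : Fin T} score θ j τ) * (∑_{t : Fin T} r (σ_τ t) (α_τ t)); that is, the policy gradient equals the expectation of the full-trajectory score multiplied by the full return (the full-return REINFORCE form of the policy gradient). -/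
open scoped BigOperators

/-- The performance objective: expected total return. -/
noncomputable def Jobj {S A : Type} [Fintype S] [Fintype A] {T : ℕ} (hT : 1 ≤ T)
    (init : S → ℝ) (trans : S → A → S → ℝ) (π : ℝ → S → A → ℝ)
    (r : S → A → ℝ) (θ : ℝ) : ℝ :=
  ∑ τ : (Fin T → S) × (Fin T → A),
    Ptraj hT init trans π θ τ * ∑ t : Fin T, r (τ.1 t) (τ.2 t)

/-- The log-derivative identity for a finite product of nonvanishing real functions. -/
theorem hasDerivAt_finset_prod_log {ι : Type*} (s : Finset ι) {f : ι → ℝ → ℝ} {x : ℝ}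
    (hf : ∀ i ∈ s, DifferentiableAt ℝ (f i) x) (hx : ∀ i ∈ s, f i x ≠ 0) :
    HasDerivAt (fun u => ∏ i ∈ s, f i u)
      ((∏ i ∈ s, f i x) * ∑ i ∈ s, deriv (fun u => Real.log (f i u)) x) x := by
  classical
  refine (HasDerivAt.fun_finsetProd fun i hi => (hf i hi).hasDerivAt).congr_deriv ?_
  rw [Finset.mul_sum]
  refine Finset.sum_congr rfl fun i hi => ?_
  rw [deriv.log (hf i hi) (hx i hi), ← Finset.prod_erase_mul s _ hi, smul_eq_mul]
  field_simp [hx i hi]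

/-- The derivative of a trajectory's probability is the probability times the total score. -/
theorem hasDerivAt_Ptraj {S A : Type} [Fintype S] [Fintype A] {T : ℕ} (hT : 1 ≤ T)
    (init : S → ℝ) (trans : S → A → S → ℝ) {π : ℝ → S → A → ℝ}
    (hπ_ne : ∀ θ s a, π θ s a ≠ 0)
    (hπ_diff : ∀ s a, Differentiable ℝ (fun θ => π θ s a))
    (θ : ℝ) (τ : (Fin T → S) × (Fin T → A)) :
    HasDerivAt (fun u => Ptraj hT init trans π u τ)
      (Ptraj hT init trans π θ τ * ∑ j : Fin T, score π θ j τ) θ := by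
  have h := hasDerivAt_finset_prod_log Finset.univ
    (f := fun (i : Fin T) u => π u (τ.1 i) (τ.2 i)) (x := θ)
    (fun i _ => hπ_diff _ _ θ) (fun i _ => hπ_ne _ _ _)
  refine ((h.const_mul (init (τ.1 ⟨0, hT⟩))).mul_const _).congr_deriv ?_
  simp only [Ptraj, score]
  ring

/-- The full-return REINFORCE form of the policy gradient: `J` is
differentiable and its derivative equals the expectation of the
full-trajectory score multiplied by the full return. -/
theorem policy_gradient_full_return
    {S A : Type} [Fintype S] [Fintype A] [Nonempty S] [Nonempty A]
    {T : ℕ} (hT : 1 ≤ T)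
    (init : S → ℝ) (hinit_nonneg : ∀ s, 0 ≤ init s) (hinit_sum : ∑ s, init s = 1)
    (trans : S → A → S → ℝ) (htrans_nonneg : ∀ s a s', 0 ≤ trans s a s')
    (htrans_sum : ∀ s a, ∑ s', trans s a s' = 1)
    (r : S → A → ℝ)
    (π : ℝ → S → A → ℝ)
    (hπ_pos : ∀ θ s a, 0 < π θ s a)
    (hπ_sum : ∀ θ s, ∑ a, π θ s a = 1)
    (hπ_diff : ∀ s a, Differentiable ℝ (fun θ => π θ s a)) :
    Differentiable ℝ (Jobj hT init trans π r) ∧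
      ∀ θ : ℝ,
        deriv (Jobj hT init trans π r) θ =
          ∑ τ : (Fin T → S) × (Fin T → A),
            Ptraj hT init trans π θ τ * (∑ j : Fin T, score π θ j τ) *
              (∑ t : Fin T, r (τ.1 t) (τ.2 t)) := by
  have h : ∀ θ, HasDerivAt (Jobj hT init trans π r)
      (∑ τ : (Fin T → S) × (Fin T → A),
        Ptraj hT init trans π θ τ * (∑ j : Fin T, score π θ j τ) *
          (∑ t : Fin T, r (τ.1 t) (τ.2 t))) θ := fun θ =>
    HasDerivAt.fun_sum fun τ _ =>
      (hasDerivAt_Ptraj hT init trans (fun θ s a => (hπ_pos θ s a).ne') hπ_diff θ τ).mul_const _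
  exact ⟨fun θ => (h θ).differentiableAt, fun θ => (h θ).deriv⟩
end
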